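/- Let S = (r; m_2, m_3, ..., m_l) be a tree eccentric sequence and let T(r; m_2,...,m_l) be the caterpillar obtained from a path v_0, v_1, ..., v_{r+l-1} by attaching m_j - 2 pendent edges to vertex v_{l+1-j} for each 2 ≤ j ≤ l. If g : ℕ → ℝ is nonnegative and nondecreasing, then for every tree T with eccentric sequence S, W(T; g) ≥ W(T(r; m_2,...,m_l); g). If g is strictly increasing, equality holds if and only if T is isomorphic to T(r; m_2,...,m_l). -/

import Mathlib

open SimpleGraph Finset

attribute [local instance] Classical.propDecidable

variable {V : Type*}

/-- The eccentricity of a vertex: the maximum distance to any other vertex. -/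
noncomputable def ecc [Fintype V] (G : SimpleGraph V) (v : V) : ℕ :=
  Finset.univ.sup fun u => G.dist v u

/-- The diameter: the maximum eccentricity. -/
noncomputable def graphDiam [Fintype V] (G : SimpleGraph V) : ℕ :=
  Finset.univ.sup fun v => ecc G v

/-- The radius: the minimum eccentricity. -/
noncomputable def graphRad [Fintype V] [Nonempty V] (G : SimpleGraph V) : ℕ :=
  Finset.univ.inf' Finset.univ_nonempty fun v => ecc G v

/-- The Wiener-type index `W(G;g)`: sum of `g (d(u,v))` over unordered pairs of
distinct vertices (here realised as half of the sum over ordered pairs). -/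
noncomputable def wiener [Fintype V] (G : SimpleGraph V) (g : ℕ → ℝ) : ℝ :=
  (∑ p ∈ Finset.univ.offDiag, g (G.dist p.1 p.2)) / 2

/-- Steiner distance of a set `A`: minimum number of edges of a subtree whose
vertex set contains `A` (in a tree, a connected subgraph on `m+1` vertices has `m` edges). -/
noncomputable def steinerDist [Fintype V] (G : SimpleGraph V) (A : Finset V) : ℕ :=
  sInf {m | ∃ S : Finset V, A ⊆ S ∧ (G.induce (S : Set V)).Connected ∧ S.card = m + 1}

/-- The `k`-Steiner Wiener index. -/
noncomputable def steinerWiener [Fintype V] (G : SimpleGraph V) (k : ℕ) : ℕ :=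
  ∑ A ∈ Finset.univ.powersetCard k, steinerDist G A

/-- A leaf (pendent vertex): a vertex of degree 1. -/
def IsLeaf (G : SimpleGraph V) (v : V) : Prop :=
  Nat.card {u : V // G.Adj v u} = 1

/-- A caterpillar: a tree in which deleting all leaves yields a path;
equivalently (for trees) every non-leaf vertex has at most two non-leaf neighbours. -/
def IsCaterpillar (G : SimpleGraph V) : Prop :=
  ∀ v : V, ¬ IsLeaf G v → Nat.card {u : V // G.Adj v u ∧ ¬ IsLeaf G u} ≤ 2

/-- Two graphs have the same eccentric sequence. -/
def sameEccSeq {W : Type*} [Fintype V] [Fintype W]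
    (G : SimpleGraph V) (H : SimpleGraph W) : Prop :=
  ∀ k : ℕ, Nat.card {v : V // ecc G v = k} = Nat.card {w : W // ecc H w = k}

/-- Vertex type of the standard caterpillar `T(r; m₂,…,m_l)`: the path
`v_0,…,v_{r+l-1}` together with `m_j - 2` pendent vertices attached at `v_{l+1-j}`
for each `2 ≤ j ≤ l` (indexed by `i = j - 2`). -/
abbrev StdVert (r l : ℕ) (m : ℕ → ℕ) : Type :=
  Fin (r + l) ⊕ ((i : Fin (l - 1)) × Fin (m (i.1 + 2) - 2))

/-- Base relation of the standard caterpillar: consecutive path vertices are adjacent,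
and each pendent vertex with index `i` (i.e. `j = i + 2`) is adjacent to `v_{l-1-i} = v_{l+1-j}`. -/
def stdRel (r l : ℕ) (m : ℕ → ℕ) : StdVert r l m → StdVert r l m → Prop
  | Sum.inl a, Sum.inl b => (a : ℕ) + 1 = (b : ℕ)
  | Sum.inr ⟨i, _⟩, Sum.inl a => (a : ℕ) = l - 1 - (i : ℕ)
  | _, _ => False

/-- The standard caterpillar `T(r; m₂,…,m_l)`. -/
def stdCat (r l : ℕ) (m : ℕ → ℕ) : SimpleGraph (StdVert r l m) :=
  SimpleGraph.fromRel (stdRel r l m)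

/-- An integral tree metric: it satisfies the four point condition, all perimeters of triangles
are even, and every intermediate distance is realised on a geodesic. -/
structure IsTreeMetric (d : V → V → ℕ) : Prop where
  eq_of_eq_zero : ∀ x y, d x y = 0 → x = y
  comm : ∀ x y, d x y = d y x
  triangle : ∀ x y z, d x z ≤ d x y + d y z
  four_point : ∀ x y u v, d x y + d u v ≤ max (d x u + d y v) (d x v + d y u)
  even_perimeter : ∀ x y z, Even (d x y + d y z + d x z)
  exists_between : ∀ x y i, i ≤ d x y → ∃ z, d x z = i ∧ d z y = d x y - i

section Tree

variable {G : SimpleGraph V}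

lemma SimpleGraph.IsTree.eq_of_adj_of_dist_lt (hG : G.IsTree) {x w a b : V}
    (ha : G.Adj a w) (hb : G.Adj b w) (hda : G.dist x a + 1 = G.dist x w)
    (hdb : G.dist x b + 1 = G.dist x w) : a = b := by
  obtain ⟨p, hp⟩ := hG.connected.exists_walk_length_eq_dist x a
  obtain ⟨q, hq⟩ := hG.connected.exists_walk_length_eq_dist x b
  have hp' : (p.concat ha).IsPath := Walk.isPath_of_length_eq_dist _ (by simp [hp, hda])
  have hq' : (q.concat hb).IsPath := Walk.isPath_of_length_eq_dist _ (by simp [hq, hdb])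
  have h := (hG.existsUnique_path x w).unique hp' hq'
  exact (Walk.concat_inj h).1

lemma SimpleGraph.IsTree.dist_add_of_nonbacktracking (hG : G.IsTree) (x : V) (Q : ℕ → V) (n : ℕ)
    (hadj : ∀ t, t < n → G.Adj (Q t) (Q (t + 1))) (hne : ∀ t, t + 2 ≤ n → Q t ≠ Q (t + 2))
    (h0 : 1 ≤ n → G.dist x (Q 0) ≤ G.dist x (Q 1)) :
    ∀ t, t ≤ n → G.dist x (Q t) = G.dist x (Q 0) + t := by
  intro t
  induction t using Nat.strong_induction_on with
  | _ t ih =>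
    intro ht
    rcases t with _ | _ | t
    · rfl
    · have h1 := hG.dist_ne_of_adj x (hadj 0 (by omega))
      have h2 := (hadj 0 (by omega)).diff_dist_adj (u := x)
      have h3 := h0 (by omega)
      simp only [zero_add] at *
      omega
    · have e0 := ih t (by omega) (by omega)
      have e1 := ih (t + 1) (by omega) (by omega)
      have h1 := hG.dist_ne_of_adj x (hadj (t + 1) (by omega))
      have h2 := (hadj (t + 1) (by omega)).diff_dist_adj (u := x)
      have h3 : ¬ (G.dist x (Q (t + 1 + 1)) + 1 = G.dist x (Q (t + 1))) := fun h =>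
        hne t ht (hG.eq_of_adj_of_dist_lt (hadj t (by omega)) (hadj (t + 1) (by omega)).symm
          (by omega) h)
      omega

lemma SimpleGraph.IsTree.exists_geodesic (hG : G.IsTree) (u v : V) :
    ∃ P : ℕ → V, P 0 = u ∧ P (G.dist u v) = v ∧
      (∀ i, i < G.dist u v → G.Adj (P i) (P (i + 1))) ∧
      (∀ i, i ≤ G.dist u v → G.dist u (P i) = i ∧ G.dist (P i) v = G.dist u v - i) ∧
      ∀ i j, i ≤ j → j ≤ G.dist u v → G.dist (P i) (P j) ≤ j - i := by
  obtain ⟨p, hp⟩ := hG.connected.exists_walk_length_eq_dist u v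
  have hadj : ∀ i, i < G.dist u v → G.Adj (p.getVert i) (p.getVert (i + 1)) := fun i hi =>
    p.adj_getVert_succ (by omega)
  have hle : ∀ t i, i + t ≤ G.dist u v → G.dist (p.getVert i) (p.getVert (i + t)) ≤ t := by
    intro t i
    induction t with
    | zero => simp
    | succ t ih =>
      intro h
      have h1 := ih (by omega)
      have h2 := hG.connected.dist_triangle (u := p.getVert i) (v := p.getVert (i + t))
        (w := p.getVert (i + t + 1))
      have h3 := dist_eq_one_iff_adj.2 (hadj (i + t) (by omega))
      rw [← add_assoc]
      omega
  have h0 : p.getVert 0 = u := p.getVert_zero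
  have hn : p.getVert (G.dist u v) = v := by rw [← hp]; exact p.getVert_length
  refine ⟨p.getVert, h0, hn, hadj, ?_, ?_⟩
  · intro i hi
    have h1 := hle i 0 (by omega)
    have h2 := hle (G.dist u v - i) i (by omega)
    have h3 := hG.connected.dist_triangle (u := u) (v := p.getVert i) (w := v)
    rw [h0, zero_add] at h1
    rw [Nat.add_sub_cancel' hi, hn] at h2
    omega
  · intro i j hij hj
    have := hle (j - i) i (by omega)
    rwa [Nat.add_sub_cancel' hij] at this

lemma SimpleGraph.IsTree.exists_proj (hG : G.IsTree) {u v : V} {P : ℕ → V}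
    (h0 : P 0 = u) (hn : P (G.dist u v) = v)
    (hadj : ∀ i, i < G.dist u v → G.Adj (P i) (P (i + 1)))
    (hd : ∀ i, i ≤ G.dist u v → G.dist u (P i) = i ∧ G.dist (P i) v = G.dist u v - i) (x : V) :
    ∃ i ≤ G.dist u v, G.dist x u = G.dist x (P i) + i ∧
      G.dist x v = G.dist x (P i) + (G.dist u v - i) := by
  obtain ⟨i, hi, hmin⟩ := Finset.exists_min_image (Finset.range (G.dist u v + 1))
    (fun i => G.dist x (P i)) ⟨0, by simp⟩
  simp only [Finset.mem_range] at hi hmin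
  have hinj : ∀ i j, i ≤ G.dist u v → j ≤ G.dist u v → P i = P j → i = j := by
    intro i j hi hj h
    rw [← (hd i hi).1, ← (hd j hj).1, h]
  refine ⟨i, by omega, ?_, ?_⟩
  · have := hG.dist_add_of_nonbacktracking x (fun t => P (i - t)) i
      (fun t ht => by
        have := (hadj (i - (t + 1)) (by omega)).symm
        rwa [show i - (t + 1) + 1 = i - t by omega] at this)
      (fun t ht h => by have := hinj _ _ (by omega) (by omega) h; omega)
      (fun h => hmin _ (by omega)) i le_rfl
    simpa [h0] using this
  · have := hG.dist_add_of_nonbacktracking x (fun t => P (i + t)) (G.dist u v - i)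
      (fun t ht => hadj (i + t) (by omega))
      (fun t ht h => by have := hinj _ _ (by omega) (by omega) h; omega)
      (fun h => hmin _ (by omega)) _ le_rfl
    simpa [show i + (G.dist u v - i) = G.dist u v by omega, hn] using this

theorem SimpleGraph.IsTree.isTreeMetric (hG : G.IsTree) : IsTreeMetric G.dist where
  eq_of_eq_zero x y h := hG.connected.dist_eq_zero_iff.1 h
  comm x y := dist_comm
  triangle x y z := hG.connected.dist_triangle
  four_point x y u v := by
    obtain ⟨P, h0, hn, hadj, hd, hle⟩ := hG.exists_geodesic u v
    obtain ⟨i, hi, hxu, hxv⟩ := hG.exists_proj h0 hn hadj hd x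
    obtain ⟨j, hj, hyu, hyv⟩ := hG.exists_proj h0 hn hadj hd y
    have h1 := hG.connected.dist_triangle (u := x) (v := P i) (w := y)
    have h2 := hG.connected.dist_triangle (u := P i) (v := P j) (w := y)
    have h3 : G.dist (P j) y = G.dist y (P j) := dist_comm
    rcases le_total i j with h | h
    · have := hle i j h hj
      omega
    · have := hle j i h hi
      have h4 : G.dist (P i) (P j) = G.dist (P j) (P i) := dist_comm
      omega
  even_perimeter x y z := by
    obtain ⟨P, h0, hn, hadj, hd, hle⟩ := hG.exists_geodesic y z
    obtain ⟨i, hi, hxu, hxv⟩ := hG.exists_proj h0 hn hadj hd x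
    rw [Nat.even_iff]
    omega
  exists_between x y i hi := by
    obtain ⟨P, -, -, -, hd, -⟩ := hG.exists_geodesic x y
    exact ⟨P i, hd i hi⟩

end Tree

/-- The sum of `g` over `A * B` distances between two classes when `B` of them equal `k`,
`A + B - 2` of them equal `M`, and the remaining ones equal `k'`. -/
def pairBound (g : ℕ → ℝ) (A B : ℕ) (k k' M : ℕ) : ℝ :=
  A * B * g k + (A * B - B) * (g k' - g k) + (A + B - 2) * (g M - g k')

section Sums

variable {X Y : Finset V} {d : V → V → ℕ} {s : V → Prop} {g : ℕ → ℝ} {k k' M : ℕ}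

lemma sum_sum_ite_iff (X Y : Finset V) (s : V → Prop) (c : ℝ) :
    ∑ x ∈ X, ∑ y ∈ Y, (if (s x ↔ s y) then 0 else c) =
      ((#{x ∈ X | s x} : ℝ) * #{y ∈ Y | ¬ s y} + (#{x ∈ X | ¬ s x} : ℝ) * #{y ∈ Y | s y}) * c := by
  have h : ∀ x ∈ X, ∑ y ∈ Y, (if (s x ↔ s y) then 0 else c) =
      if s x then (#{y ∈ Y | ¬ s y} : ℝ) * c else (#{y ∈ Y | s y} : ℝ) * c := by
    intro x _
    by_cases hx : s x
    · simp only [hx, true_iff, if_true]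
      rw [Finset.sum_ite, Finset.sum_const_zero, zero_add, Finset.sum_const, nsmul_eq_mul]
    · simp only [hx, false_iff, if_false]
      rw [Finset.sum_ite, Finset.sum_const_zero, zero_add, Finset.sum_const, nsmul_eq_mul]
      simp only [not_not]
  rw [Finset.sum_congr rfl h, Finset.sum_ite, Finset.sum_const, Finset.sum_const]
  simp only [nsmul_eq_mul]
  ring

lemma sum_sum_ite_zero (X Y : Finset V) (n : V → V → Prop) (c : ℝ) :
    ∑ x ∈ X, ∑ y ∈ Y, (if n x y then 0 else c) =
      (#X * #Y - ∑ y ∈ Y, (#{x ∈ X | n x y} : ℝ)) * c := by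
  rw [Finset.sum_comm, sub_mul, Finset.sum_mul]
  have h : ∀ y ∈ Y, ∑ x ∈ X, (if n x y then 0 else c) = #X * c - #{x ∈ X | n x y} * c := by
    intro y _
    rw [Finset.sum_ite, Finset.sum_const_zero, zero_add, Finset.sum_const, nsmul_eq_mul, ← sub_mul,
      ← Finset.card_filter_add_card_filter_not (s := X) (fun x => n x y)]
    push_cast
    ring
  rw [Finset.sum_congr rfl h, Finset.sum_sub_distrib, Finset.sum_const, nsmul_eq_mul]
  ring

/-- The pointwise model for `g (d x y)`: `n` marks the pairs at minimal distance and the colouring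
`s` the pairs at maximal distance. -/
noncomputable def pairModel (g : ℕ → ℝ) (n : V → V → Prop) (s : V → Prop) (k k' M : ℕ)
    (x y : V) : ℝ :=
  g k + (if n x y then 0 else g k' - g k) + if (s x ↔ s y) then 0 else g M - g k'

lemma sum_pairModel (X Y : Finset V) (n : V → V → Prop) (s : V → Prop) :
    ∑ x ∈ X, ∑ y ∈ Y, pairModel g n s k k' M x y =
      #X * #Y * g k + (#X * #Y - ∑ y ∈ Y, (#{x ∈ X | n x y} : ℝ)) * (g k' - g k) +
      ((#{x ∈ X | s x} : ℝ) * #{y ∈ Y | ¬ s y} + (#{x ∈ X | ¬ s x} : ℝ) * #{y ∈ Y | s y}) *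
        (g M - g k') := by
  unfold pairModel
  simp only [Finset.sum_add_distrib]
  rw [sum_sum_ite_iff, sum_sum_ite_zero]
  simp only [Finset.sum_const, nsmul_eq_mul]
  ring

lemma sum_card_filter_le {n : V → V → Prop}
    (hn : ∀ y ∈ Y, ∀ x₁ ∈ X, ∀ x₂ ∈ X, n x₁ y → n x₂ y → x₁ = x₂) :
    (∑ y ∈ Y, (#{x ∈ X | n x y} : ℝ)) ≤ #Y := by
  calc _ ≤ ∑ y ∈ Y, (1 : ℝ) := Finset.sum_le_sum fun y hy => by
        have : #{x ∈ X | n x y} ≤ 1 := Finset.card_le_one.2 fun a ha b hb => by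
          rw [Finset.mem_filter] at ha hb
          exact hn y hy a ha.1 b hb.1 ha.2 hb.2
        exact_mod_cast this
    _ = #Y := by simp

lemma le_sum_card_filter {n : V → V → Prop} (hn : ∀ y ∈ Y, ∃ x ∈ X, n x y) :
    (#Y : ℝ) ≤ ∑ y ∈ Y, (#{x ∈ X | n x y} : ℝ) := by
  calc (#Y : ℝ) = ∑ y ∈ Y, (1 : ℝ) := by simp
    _ ≤ _ := Finset.sum_le_sum fun y hy => by
        obtain ⟨x, hx, hxy⟩ := hn y hy
        exact_mod_cast Finset.card_pos.2 ⟨x, by simp [hx, hxy]⟩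

lemma pairBound_le_sum_pairModel (hg : Monotone g) (hk : k ≤ k') (hM : k' ≤ M)
    {n : V → V → Prop} (hn : ∀ y ∈ Y, ∀ x₁ ∈ X, ∀ x₂ ∈ X, n x₁ y → n x₂ y → x₁ = x₂)
    (hX : k' < M → (∃ x ∈ X, s x) ∧ ∃ x ∈ X, ¬ s x)
    (hY : k' < M → (∃ y ∈ Y, s y) ∧ ∃ y ∈ Y, ¬ s y) :
    pairBound g #X #Y k k' M ≤ ∑ x ∈ X, ∑ y ∈ Y, pairModel g n s k k' M x y := by
  rw [sum_pairModel, pairBound]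
  have h1 := sum_card_filter_le hn
  have h2 : (0 : ℝ) ≤ g k' - g k := sub_nonneg.2 (hg hk)
  have h3 : ((#X : ℝ) + #Y - 2) * (g M - g k') ≤
      ((#{x ∈ X | s x} : ℝ) * #{y ∈ Y | ¬ s y} + (#{x ∈ X | ¬ s x} : ℝ) * #{y ∈ Y | s y}) *
        (g M - g k') := by
    rcases hM.eq_or_lt with rfl | hlt
    · simp
    · refine mul_le_mul_of_nonneg_right ?_ (sub_nonneg.2 (hg hM))
      obtain ⟨⟨a, ha, hsa⟩, b, hb, hsb⟩ := hX hlt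
      obtain ⟨⟨u, hu, hsu⟩, v, hv, hsv⟩ := hY hlt
      have c1 : (1 : ℝ) ≤ #{x ∈ X | s x} := by
        exact_mod_cast Finset.card_pos.2 ⟨a, by simp [ha, hsa]⟩
      have c2 : (1 : ℝ) ≤ #{x ∈ X | ¬ s x} := by
        exact_mod_cast Finset.card_pos.2 ⟨b, by simp [hb, hsb]⟩
      have c3 : (1 : ℝ) ≤ #{x ∈ Y | s x} := by
        exact_mod_cast Finset.card_pos.2 ⟨u, by simp [hu, hsu]⟩
      have c4 : (1 : ℝ) ≤ #{x ∈ Y | ¬ s x} := by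
        exact_mod_cast Finset.card_pos.2 ⟨v, by simp [hv, hsv]⟩
      rw [← Finset.card_filter_add_card_filter_not (s := X) s,
        ← Finset.card_filter_add_card_filter_not (s := Y) s]
      push_cast
      nlinarith [mul_nonneg (sub_nonneg.2 c1) (sub_nonneg.2 c4),
        mul_nonneg (sub_nonneg.2 c2) (sub_nonneg.2 c3)]
  nlinarith [mul_le_mul_of_nonneg_right h1 h2]

lemma pairModel_le (hg : Monotone g) (hk : k ≤ k') (hM : k' ≤ M) {x y : V}
    (h2 : d x y ≠ k → k' ≤ d x y) (h3 : ¬ (s x ↔ s y) → M ≤ d x y) :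
    pairModel g (fun x y => d x y = k) s k k' M x y ≤ g (d x y) := by
  unfold pairModel
  by_cases hd : d x y = k <;> by_cases hs : (s x ↔ s y)
  · simp [hd, hs]
  · have h := h3 hs
    obtain rfl : k = k' := by omega
    obtain rfl : k = M := by omega
    simp [hd]
  · simpa [hd, hs] using hg (h2 hd)
  · simpa [hd, hs] using hg (h3 hs)

lemma pairBound_le_sum (hg : Monotone g) (hk : k ≤ k') (hM : k' ≤ M)
    (h2 : ∀ x ∈ X, ∀ y ∈ Y, d x y ≠ k → k' ≤ d x y)
    (h3 : ∀ x ∈ X, ∀ y ∈ Y, ¬ (s x ↔ s y) → M ≤ d x y)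
    (hn : ∀ y ∈ Y, ∀ x₁ ∈ X, ∀ x₂ ∈ X, d x₁ y = k → d x₂ y = k → x₁ = x₂)
    (hX : k' < M → (∃ x ∈ X, s x) ∧ ∃ x ∈ X, ¬ s x)
    (hY : k' < M → (∃ y ∈ Y, s y) ∧ ∃ y ∈ Y, ¬ s y) :
    pairBound g #X #Y k k' M ≤ ∑ x ∈ X, ∑ y ∈ Y, g (d x y) :=
  (pairBound_le_sum_pairModel hg hk hM hn hX hY).trans <|
    Finset.sum_le_sum fun x hx => Finset.sum_le_sum fun y hy =>
      pairModel_le hg hk hM (h2 x hx y hy) (h3 x hx y hy)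

lemma of_sum_le_pairBound (hg : StrictMono g) (hk : k ≤ k') (hM : k' ≤ M)
    (h2 : ∀ x ∈ X, ∀ y ∈ Y, d x y ≠ k → k' ≤ d x y)
    (h3 : ∀ x ∈ X, ∀ y ∈ Y, ¬ (s x ↔ s y) → M ≤ d x y)
    (hn : ∀ y ∈ Y, ∀ x₁ ∈ X, ∀ x₂ ∈ X, d x₁ y = k → d x₂ y = k → x₁ = x₂)
    (hX : k' < M → (∃ x ∈ X, s x) ∧ ∃ x ∈ X, ¬ s x)
    (hY : k' < M → (∃ y ∈ Y, s y) ∧ ∃ y ∈ Y, ¬ s y)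
    (hle : ∑ x ∈ X, ∑ y ∈ Y, g (d x y) ≤ pairBound g #X #Y k k' M) :
    (∀ x ∈ X, ∀ y ∈ Y, (s x ↔ s y) → d x y ≤ k') ∧
    (k' < M → ∀ x ∈ X, ∀ x' ∈ X, ∀ y ∈ Y, ∀ y' ∈ Y, x ≠ x' → y ≠ y' →
      s x → s x' → ¬ s y → ¬ s y' → False) := by
  have hmono := hg.monotone
  have hA := pairBound_le_sum_pairModel hmono hk hM hn hX hY
  have hpt : ∀ x ∈ X, ∀ y ∈ Y, _ ≤ g (d x y) := fun x hx y hy =>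
    pairModel_le hmono hk hM (h2 x hx y hy) (h3 x hx y hy)
  have hrow : ∀ x ∈ X, _ ≤ ∑ y ∈ Y, g (d x y) := fun x hx => Finset.sum_le_sum (hpt x hx)
  have hB := Finset.sum_le_sum hrow
  constructor
  · intro x hx y hy hs
    have e1 := (Finset.sum_eq_sum_iff_of_le hrow).1 (by linarith) x hx
    have e2 := (Finset.sum_eq_sum_iff_of_le (hpt x hx)).1 e1 y hy
    by_contra! hlt
    have hdk : d x y ≠ k := by omega
    simp only [pairModel, hdk, hs, if_true, if_false] at e2
    have := hg hlt
    linarith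
  · intro hlt x hx x' hx' y hy y' hy' hxx hyy sx sx' sy sy'
    have hE : pairBound g #X #Y k k' M =
      ∑ x ∈ X, ∑ y ∈ Y, pairModel g (fun x y => d x y = k) s k k' M x y := by linarith
    obtain ⟨-, b, hb, hsb⟩ := hX hlt
    obtain ⟨⟨u, hu, hsu⟩, -⟩ := hY hlt
    have c1 : (2 : ℝ) ≤ #{x ∈ X | s x} := by
      exact_mod_cast Finset.one_lt_card.2 ⟨x, by simp [hx, sx], x', by simp [hx', sx'], hxx⟩
    have c2 : (1 : ℝ) ≤ #{x ∈ X | ¬ s x} := by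
      exact_mod_cast Finset.card_pos.2 ⟨b, by simp [hb, hsb]⟩
    have c3 : (1 : ℝ) ≤ #{x ∈ Y | s x} := by
      exact_mod_cast Finset.card_pos.2 ⟨u, by simp [hu, hsu]⟩
    have c4 : (2 : ℝ) ≤ #{x ∈ Y | ¬ s x} := by
      exact_mod_cast Finset.one_lt_card.2 ⟨y, by simp [hy, sy], y', by simp [hy', sy'], hyy⟩
    have h4 := sum_card_filter_le (n := fun x y => d x y = k) hn
    rw [sum_pairModel, pairBound] at hE
    have h5 : (0 : ℝ) ≤ g k' - g k := sub_nonneg.2 (hmono hk)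
    have h6 : (0 : ℝ) < g M - g k' := sub_pos.2 (hg hlt)
    have h7 : ((#X : ℝ) + #Y - 2) * (g M - g k') <
      ((#{x ∈ X | s x} : ℝ) * #{y ∈ Y | ¬ s y} + (#{x ∈ X | ¬ s x} : ℝ) * #{y ∈ Y | s y}) *
        (g M - g k') := by
      refine mul_lt_mul_of_pos_right ?_ h6
      rw [← Finset.card_filter_add_card_filter_not (s := X) s,
        ← Finset.card_filter_add_card_filter_not (s := Y) s]
      push_cast
      nlinarith [mul_nonneg (sub_nonneg.2 c1) (sub_nonneg.2 c4),
        mul_nonneg (sub_nonneg.2 c2) (sub_nonneg.2 c3)]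
    nlinarith [mul_le_mul_of_nonneg_right h4 h5]

lemma sum_le_pairBound (hg : Monotone g) (hk : k ≤ k') (hM : k' ≤ M)
    (h2 : ∀ x ∈ X, ∀ y ∈ Y, (s x ↔ s y) → k < d x y → d x y ≤ k')
    (h3 : ∀ x ∈ X, ∀ y ∈ Y, ¬ (s x ↔ s y) → d x y ≤ M)
    (hn : ∀ y ∈ Y, ∃ x ∈ X, d x y ≤ k)
    (hX : k' < M → #{x ∈ X | s x} = 1) (hY : k' < M → #{y ∈ Y | s y} = 1) :
    ∑ x ∈ X, ∑ y ∈ Y, g (d x y) ≤ pairBound g #X #Y k k' M := by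
  have hpt : ∑ x ∈ X, ∑ y ∈ Y, g (d x y) ≤
      ∑ x ∈ X, ∑ y ∈ Y, pairModel g (fun x y => d x y ≤ k) s k k' M x y := by
    refine Finset.sum_le_sum fun x hx => Finset.sum_le_sum fun y hy => ?_
    have g1 := hg hk
    have g2 := hg hM
    unfold pairModel
    by_cases hd : d x y ≤ k <;> by_cases hs : (s x ↔ s y)
    · simpa [hd, hs] using hg hd
    · simp only [hd, hs, if_true, if_false]
      have := hg hd
      linarith
    · simpa [hd, hs] using hg (h2 x hx y hy hs (by omega))
    · simpa [hd, hs] using hg (h3 x hx y hy hs)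
  refine hpt.trans ?_
  rw [sum_pairModel, pairBound]
  have h1 := le_sum_card_filter (n := fun x y => d x y ≤ k) hn
  have h2 : (0 : ℝ) ≤ g k' - g k := sub_nonneg.2 (hg hk)
  have h3 : ((#{x ∈ X | s x} : ℝ) * #{y ∈ Y | ¬ s y} + (#{x ∈ X | ¬ s x} : ℝ) * #{y ∈ Y | s y}) *
        (g M - g k') = ((#X : ℝ) + #Y - 2) * (g M - g k') := by
    rcases hM.eq_or_lt with rfl | hlt
    · simp
    · rw [← Finset.card_filter_add_card_filter_not (s := X) s,
        ← Finset.card_filter_add_card_filter_not (s := Y) s, hX hlt, hY hlt]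
      push_cast
      ring
  nlinarith [mul_le_mul_of_nonneg_right h1 h2]

end Sums

section StdCat

variable {r l : ℕ} {m : ℕ → ℕ}

/-- The coordinate of a vertex of the standard caterpillar, pendent vertices being put next to
their neighbour on the side of `v_0`. -/
def stdPos : StdVert r l m → ℕ
  | Sum.inl a => a
  | Sum.inr ⟨i, _⟩ => l - 2 - i

lemma stdCat_adj_inl {a b : Fin (r + l)} (h : (a : ℕ) + 1 = b) :
    (stdCat r l m).Adj (Sum.inl a) (Sum.inl b) := by
  rw [stdCat, SimpleGraph.fromRel_adj]
  refine ⟨fun hab => ?_, Or.inl h⟩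
  rw [Sum.inl.injEq] at hab
  subst hab
  omega

lemma stdCat_adj_inr {p : (i : Fin (l - 1)) × Fin (m (i.1 + 2) - 2)} {a : Fin (r + l)}
    (h : (a : ℕ) = l - 1 - p.1) : (stdCat r l m).Adj (Sum.inr p) (Sum.inl a) := by
  rw [stdCat, SimpleGraph.fromRel_adj]
  exact ⟨Sum.inr_ne_inl, Or.inl h⟩

lemma stdPos_of_adj {u v : StdVert r l m} (h : (stdCat r l m).Adj u v) :
    stdPos u ≤ stdPos v + 1 ∧ stdPos v ≤ stdPos u + 1 := by
  rw [stdCat, SimpleGraph.fromRel_adj] at h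
  rcases u with a | ⟨i, t⟩ <;> rcases v with b | ⟨j, t'⟩ <;>
    simp only [stdRel, stdPos, or_false, false_or, or_self, and_false] at h ⊢ <;> omega

lemma stdPos_le_of_walk {u v : StdVert r l m} (w : (stdCat r l m).Walk u v) :
    stdPos u ≤ stdPos v + w.length ∧ stdPos v ≤ stdPos u + w.length := by
  induction w with
  | nil => simp
  | cons h p ih =>
    have := stdPos_of_adj h
    rw [Walk.length_cons]
    omega

lemma exists_walk_inl (n : ℕ) : ∀ a b : Fin (r + l), (a : ℕ) + n = b →
    ∃ w : (stdCat r l m).Walk (Sum.inl a) (Sum.inl b), w.length = n := by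
  induction n with
  | zero =>
    intro a b h
    obtain rfl : a = b := Fin.ext (by omega)
    exact ⟨Walk.nil, rfl⟩
  | succ n ih =>
    intro a b h
    obtain ⟨w, hw⟩ := ih ⟨a + 1, by omega⟩ b (by simp only; omega)
    exact ⟨Walk.cons (stdCat_adj_inl rfl) w, by simp [hw]⟩

lemma exists_walk_inl_inl (a b : Fin (r + l)) :
    ∃ w : (stdCat r l m).Walk (Sum.inl a) (Sum.inl b), w.length = (a - b : ℕ) + (b - a : ℕ) := by
  rcases le_total (a : ℕ) b with h | h
  · obtain ⟨w, hw⟩ := exists_walk_inl (m := m) (b - a) a b (by omega)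
    exact ⟨w, by omega⟩
  · obtain ⟨w, hw⟩ := exists_walk_inl (m := m) (a - b) b a (by omega)
    exact ⟨w.reverse, by rw [Walk.length_reverse]; omega⟩

lemma exists_walk_inr_inl (p : (i : Fin (l - 1)) × Fin (m (i.1 + 2) - 2)) (b : Fin (r + l)) :
    ∃ w : (stdCat r l m).Walk (Sum.inr p) (Sum.inl b),
      w.length = (l - 1 - p.1 - b : ℕ) + (b - (l - 1 - p.1) : ℕ) + 1 := by
  obtain ⟨w, hw⟩ := exists_walk_inl_inl (m := m) ⟨l - 1 - p.1, by omega⟩ b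
  exact ⟨Walk.cons (stdCat_adj_inr rfl) w, by simp only at hw; simp [hw]⟩

lemma exists_walk_inr_inr (p q : (i : Fin (l - 1)) × Fin (m (i.1 + 2) - 2)) :
    ∃ w : (stdCat r l m).Walk (Sum.inr p) (Sum.inr q),
      w.length = (p.1 - q.1 : ℕ) + (q.1 - p.1 : ℕ) + 2 := by
  obtain ⟨w, hw⟩ := exists_walk_inr_inl (r := r) (m := m) p ⟨l - 1 - q.1, by omega⟩
  exact ⟨w.concat (stdCat_adj_inr rfl).symm, by rw [Walk.length_concat, hw]; simp only; omega⟩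

lemma stdCat_reachable (u v : StdVert r l m) : (stdCat r l m).Reachable u v := by
  rcases u with a | p <;> rcases v with b | q
  · exact ⟨(exists_walk_inl_inl a b).choose⟩
  · exact ⟨(exists_walk_inr_inl q a).choose.reverse⟩
  · exact ⟨(exists_walk_inr_inl p b).choose⟩
  · exact ⟨(exists_walk_inr_inr p q).choose⟩

lemma stdPos_le_dist (u v : StdVert r l m) :
    stdPos u ≤ stdPos v + (stdCat r l m).dist u v ∧
      stdPos v ≤ stdPos u + (stdCat r l m).dist u v := by
  obtain ⟨w, hw⟩ := (stdCat_reachable u v).exists_walk_length_eq_dist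
  rw [← hw]
  exact stdPos_le_of_walk w

lemma dist_inl_inl_le (a b : Fin (r + l)) :
    (stdCat r l m).dist (Sum.inl a) (Sum.inl b) ≤ (a - b : ℕ) + (b - a : ℕ) := by
  obtain ⟨w, hw⟩ := exists_walk_inl_inl (m := m) a b
  exact hw ▸ dist_le w

lemma dist_inr_inl_le (p : (i : Fin (l - 1)) × Fin (m (i.1 + 2) - 2)) (b : Fin (r + l)) :
    (stdCat r l m).dist (Sum.inr p) (Sum.inl b) ≤
      (l - 1 - p.1 - b : ℕ) + (b - (l - 1 - p.1) : ℕ) + 1 := by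
  obtain ⟨w, hw⟩ := exists_walk_inr_inl (r := r) (m := m) p b
  exact hw ▸ dist_le w

lemma dist_inr_inr_le (p q : (i : Fin (l - 1)) × Fin (m (i.1 + 2) - 2)) :
    (stdCat r l m).dist (Sum.inr p) (Sum.inr q) ≤ (p.1 - q.1 : ℕ) + (q.1 - p.1 : ℕ) + 2 := by
  obtain ⟨w, hw⟩ := exists_walk_inr_inr (r := r) (m := m) p q
  exact hw ▸ dist_le w

/-- Distances in the standard caterpillar exceed the difference of coordinates by at most two. -/
lemma stdCat_dist_le (u v : StdVert r l m) :
    (stdCat r l m).dist u v ≤ (stdPos u - stdPos v) + (stdPos v - stdPos u) + 2 := by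
  rcases u with a | ⟨i, t⟩ <;> rcases v with b | ⟨j, t'⟩
  · have := dist_inl_inl_le (m := m) a b
    simp only [stdPos]
    omega
  · have := dist_inr_inl_le (r := r) ⟨j, t'⟩ a
    rw [dist_comm] at this
    simp only [stdPos] at this ⊢
    omega
  · have := dist_inr_inl_le (r := r) ⟨i, t⟩ b
    simp only [stdPos] at this ⊢
    omega
  · have := dist_inr_inr_le (r := r) ⟨i, t⟩ ⟨j, t'⟩
    simp only [stdPos] at this ⊢
    omega

/-- Seen from a path vertex, a vertex with smaller coordinate is at distance the difference of
the coordinates. -/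
lemma stdCat_dist_inl_le {u : StdVert r l m} {b : Fin (r + l)} (h : stdPos u < b) :
    (stdCat r l m).dist u (Sum.inl b) ≤ b - stdPos u := by
  rcases u with a | ⟨i, t⟩
  · have := dist_inl_inl_le (m := m) a b
    simp only [stdPos] at h ⊢
    omega
  · have := dist_inr_inl_le (r := r) ⟨i, t⟩ b
    simp only [stdPos] at this h ⊢
    omega

lemma stdPos_le (hl : 2 ≤ l) (u : StdVert r l m) : stdPos u ≤ r + l - 1 := by
  rcases u with a | ⟨i, t⟩ <;> simp only [stdPos] <;> omega

lemma ecc_stdCat (hr : 1 ≤ r) (hl : 2 ≤ l) (hrl : l = r ∨ l = r + 1) (u : StdVert r l m) :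
    ecc (stdCat r l m) u = max (stdPos u) (r + l - 1 - stdPos u) := by
  apply le_antisymm
  · refine Finset.sup_le fun v _ => ?_
    have hgen := stdCat_dist_le u v
    rcases u with a | ⟨i, t⟩ <;> rcases v with b | ⟨j, t'⟩
    · have := dist_inl_inl_le (m := m) a b
      simp only [stdPos]
      omega
    · have h2 := fun h => stdCat_dist_inl_le (r := r) (u := Sum.inr ⟨j, t'⟩) (b := a) h
      rw [dist_comm] at h2
      simp only [stdPos] at hgen h2 ⊢
      omega
    · have h2 := fun h => stdCat_dist_inl_le (r := r) (u := Sum.inr ⟨i, t⟩) (b := b) h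
      simp only [stdPos] at hgen h2 ⊢
      omega
    · simp only [stdPos] at hgen ⊢
      omega
  · have h1 : (stdCat r l m).dist u (Sum.inl ⟨0, by omega⟩) ≤ ecc (stdCat r l m) u :=
      Finset.le_sup (f := fun v => (stdCat r l m).dist u v) (Finset.mem_univ _)
    have h2 : (stdCat r l m).dist u (Sum.inl ⟨r + l - 1, by omega⟩) ≤ ecc (stdCat r l m) u :=
      Finset.le_sup (f := fun v => (stdCat r l m).dist u v) (Finset.mem_univ _)
    have h3 := stdPos_le_dist u (Sum.inl ⟨0, by omega⟩)
    have h4 := stdPos_le_dist u (Sum.inl ⟨r + l - 1, by omega⟩)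
    simp only [stdPos] at h3 h4 ⊢
    omega

end StdCat

/-- The vertices of eccentricity `k`. -/
noncomputable def eccClass [Fintype V] (G : SimpleGraph V) (k : ℕ) : Finset V :=
  {v | ecc G v = k}

lemma mem_eccClass [Fintype V] {G : SimpleGraph V} {k : ℕ} {v : V} :
    v ∈ eccClass G k ↔ ecc G v = k := by
  simp [eccClass]

section StdCatSum

variable {r l : ℕ} {m : ℕ → ℕ} {k₁ k₂ : ℕ}

lemma card_eccClass_stdCat_filter (hr : 1 ≤ r) (hl : 2 ≤ l) (hrl : l = r ∨ l = r + 1)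
    {k : ℕ} (hk : r + l - 1 < 2 * k) (hkD : k ≤ r + l - 1) :
    #{u ∈ eccClass (stdCat r l m) k | r + l - 1 < 2 * stdPos u} = 1 := by
  rw [Finset.card_eq_one]
  refine ⟨Sum.inl ⟨k, by omega⟩, Finset.ext fun u => ?_⟩
  rw [Finset.mem_filter, mem_eccClass, ecc_stdCat hr hl hrl, Finset.mem_singleton]
  constructor
  · rintro ⟨h1, h2⟩
    rcases u with a | ⟨i, t⟩
    · simp only [stdPos] at h1 h2
      congr 1
      exact Fin.ext (by simp only; omega)
    · simp only [stdPos] at h1 h2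
      omega
  · rintro rfl
    simp only [stdPos]
    omega

lemma sum_eccClass_stdCat_le (hr : 1 ≤ r) (hl : 2 ≤ l) (hrl : l = r ∨ l = r + 1)
    {g : ℕ → ℝ} (hg : Monotone g) (h₁ : r + l - 1 ≤ 2 * k₁) (h₁₂ : k₁ ≤ k₂) (h₂ : k₂ ≤ r + l - 1) :
    ∑ x ∈ eccClass (stdCat r l m) k₁, ∑ y ∈ eccClass (stdCat r l m) k₂,
        g ((stdCat r l m).dist x y) ≤
      pairBound g #(eccClass (stdCat r l m) k₁) #(eccClass (stdCat r l m) k₂) (k₂ - k₁)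
        (min (k₂ - k₁ + 2) (k₁ + k₂ - (r + l - 1))) (k₁ + k₂ - (r + l - 1)) := by
  refine sum_le_pairBound (s := fun u => r + l - 1 < 2 * stdPos u) hg (by omega) (by omega)
    ?_ ?_ ?_
    (fun h => by convert card_eccClass_stdCat_filter hr hl hrl (k := k₁) (by omega) (by omega))
    (fun h => by convert card_eccClass_stdCat_filter hr hl hrl (k := k₂) (by omega) (by omega))
  · intro x hx y hy hs hlt
    rw [mem_eccClass, ecc_stdCat hr hl hrl] at hx hy
    have hgen := stdCat_dist_le x y
    rcases x with a | ⟨i, t⟩ <;> rcases y with b | ⟨j, t'⟩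
    · have := dist_inl_inl_le (m := m) a b
      simp only [stdPos] at *
      omega
    · have h2 := fun h => stdCat_dist_inl_le (r := r) (u := Sum.inr ⟨j, t'⟩) (b := a) h
      rw [SimpleGraph.dist_comm] at h2
      simp only [stdPos] at *
      omega
    · simp only [stdPos] at *
      omega
    · simp only [stdPos] at *
      omega
  · intro x hx y hy hs
    rw [mem_eccClass, ecc_stdCat hr hl hrl] at hx hy
    rcases x with a | ⟨i, t⟩ <;> rcases y with b | ⟨j, t'⟩
    · have := dist_inl_inl_le (m := m) a b
      simp only [stdPos] at *
      omega
    · have h2 := fun h => stdCat_dist_inl_le (r := r) (u := Sum.inr ⟨j, t'⟩) (b := a) h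
      rw [SimpleGraph.dist_comm] at h2
      simp only [stdPos] at *
      omega
    · have h2 := fun h => stdCat_dist_inl_le (r := r) (u := Sum.inr ⟨i, t⟩) (b := b) h
      simp only [stdPos] at *
      omega
    · simp only [stdPos] at *
      omega
  · intro y hy
    have hyD := stdPos_le hl y
    rw [mem_eccClass, ecc_stdCat hr hl hrl] at hy
    by_cases hpos : r + l - 1 < 2 * stdPos y
    · refine ⟨Sum.inl ⟨k₁, by omega⟩, ?_, ?_⟩
      · rw [mem_eccClass, ecc_stdCat hr hl hrl]
        simp only [stdPos]
        omega
      · rcases y with b | ⟨j, t'⟩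
        · have := dist_inl_inl_le (m := m) ⟨k₁, by omega⟩ b
          simp only [stdPos] at hy hpos this
          omega
        · simp only [stdPos] at hy hpos
          omega
    · rcases h₁₂.eq_or_lt with rfl | hlt
      · exact ⟨y, by rw [mem_eccClass, ecc_stdCat hr hl hrl]; exact hy, by simp⟩
      · refine ⟨Sum.inl ⟨r + l - 1 - k₁, by omega⟩, ?_, ?_⟩
        · rw [mem_eccClass, ecc_stdCat hr hl hrl]
          simp only [stdPos]
          omega
        · have := stdCat_dist_inl_le (u := y) (b := ⟨r + l - 1 - k₁, by omega⟩)
            (by simp only; omega)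
          rw [SimpleGraph.dist_comm]
          simp only at this
          omega

end StdCatSum

section TreeMetric

variable {d : V → V → ℕ} {p q : V}

lemma IsTreeMetric.perim_le (hd : IsTreeMetric d) (p q x : V) : d p q ≤ d p x + d q x := by
  have := hd.triangle p x q
  rwa [hd.comm x q] at this

/-- In a tree, every eccentricity is the distance to one of the ends of a diametral path. -/
lemma ecc_eq_max [Fintype V] {G : SimpleGraph V} (hd : IsTreeMetric G.dist)
    (hD : ∀ x y, G.dist x y ≤ G.dist p q) (x : V) :
    ecc G x = max (G.dist p x) (G.dist q x) := by
  apply le_antisymm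
  · refine Finset.sup_le fun y _ => ?_
    have h1 := hd.four_point x y p q
    have h2 := hD p y
    have h3 := hD q y
    rw [hd.comm x p, hd.comm x q, hd.comm y p, hd.comm y q] at h1
    omega
  · have h1 : G.dist x p ≤ ecc G x :=
      Finset.le_sup (f := fun v => G.dist x v) (Finset.mem_univ p)
    have h2 : G.dist x q ≤ ecc G x :=
      Finset.le_sup (f := fun v => G.dist x v) (Finset.mem_univ q)
    rw [hd.comm p x, hd.comm q x]
    exact max_le h1 h2

lemma IsTreeMetric.le_dist_of_cross (hd : IsTreeMetric d) {x y : V} (hx : d p x ≤ d q x)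
    (hy : d q y < d p y) : d q x + d p y ≤ d x y + d p q := by
  have h1 := hd.four_point x q p y
  have h2 := hd.four_point x p q y
  rw [hd.comm x p, hd.comm x q, hd.comm q p] at *
  omega

variable {D k₁ k₂ : ℕ}

lemma IsTreeMetric.le_dist_of_not_iff (hd : IsTreeMetric d) {x y : V} (hD : d p q = D)
    (hx : max (d p x) (d q x) = k₁) (hy : max (d p y) (d q y) = k₂)
    (hs : ¬ (d q x < d p x ↔ d q y < d p y)) : k₁ + k₂ - D ≤ d x y := by
  by_cases h : d q x < d p x
  · have := hd.le_dist_of_cross (p := p) (q := q) (x := y) (y := x)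
      (not_lt.1 fun h' => hs (iff_of_true h h')) h
    rw [hd.comm y x] at this
    omega
  · have := hd.le_dist_of_cross (p := p) (q := q) (x := x) (y := y) (by omega) (by tauto)
    omega

lemma IsTreeMetric.min_le_dist (hd : IsTreeMetric d) {x y : V} (hD : d p q = D)
    (hx : max (d p x) (d q x) = k₁) (hy : max (d p y) (d q y) = k₂)
    (hne : d x y ≠ k₂ - k₁) (h₁₂ : k₁ ≤ k₂) :
    min (k₂ - k₁ + 2) (k₁ + k₂ - D) ≤ d x y := by
  by_cases hs : (d q x < d p x ↔ d q y < d p y)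
  · have h1 := hd.triangle p x y
    have h2 := hd.triangle q x y
    have h3 := hd.even_perimeter p x y
    have h4 := hd.even_perimeter q x y
    rw [Nat.even_iff] at h3 h4
    by_cases h : d q x < d p x
    · have := hs.1 h
      omega
    · have : ¬ d q y < d p y := fun h' => h (hs.2 h')
      omega
  · have := hd.le_dist_of_not_iff hD hx hy hs
    omega

lemma IsTreeMetric.eq_of_dist_eq (hd : IsTreeMetric d) {x x' y : V} (hD : d p q = D)
    (hx : max (d p x) (d q x) = k₁) (hx' : max (d p x') (d q x') = k₁)
    (hy : max (d p y) (d q y) = k₂) (h₁₂ : k₁ ≤ k₂) (h₁ : D ≤ 2 * k₁)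
    (h : d x y = k₂ - k₁) (h' : d x' y = k₂ - k₁) : x = x' := by
  apply hd.eq_of_eq_zero
  have e1 := hd.perim_le p q x
  have e2 := hd.perim_le p q x'
  have fp := hd.four_point x x' p y
  have fq := hd.four_point x x' q y
  have fpq := hd.four_point x x' p q
  have c1 := fun hs => hd.le_dist_of_not_iff hD hx hy hs
  have c2 := fun hs => hd.le_dist_of_not_iff hD hx' hy hs
  rw [hd.comm x p, hd.comm x' p] at fp fpq
  rw [hd.comm x q, hd.comm x' q] at fq fpq
  by_cases h2 : D = 2 * k₁
  · omega
  · have s1 : (d q x < d p x ↔ d q y < d p y) := by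
      by_contra hs
      have := c1 hs
      omega
    have s2 : (d q x' < d p x' ↔ d q y < d p y) := by
      by_contra hs
      have := c2 hs
      omega
    by_cases hy' : d q y < d p y
    · have := s1.2 hy'
      have := s2.2 hy'
      omega
    · have : ¬ d q x < d p x := fun hh => hy' (s1.1 hh)
      have : ¬ d q x' < d p x' := fun hh => hy' (s2.1 hh)
      omega

lemma IsTreeMetric.exists_right (hd : IsTreeMetric d) (hD : d p q = D) {k : ℕ}
    (hkD : k ≤ D) : ∃ z, d p z = k ∧ d q z = D - k := by
  obtain ⟨z, h1, h2⟩ := hd.exists_between p q k (by omega)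
  exact ⟨z, h1, by rw [hd.comm, h2, hD]⟩

lemma IsTreeMetric.exists_left (hd : IsTreeMetric d) (hD : d p q = D) {k : ℕ}
    (hkD : k ≤ D) : ∃ z, d q z = k ∧ d p z = D - k := by
  obtain ⟨z, h1, h2⟩ := hd.exists_between p q (D - k) (by omega)
  exact ⟨z, by rw [hd.comm, h2]; omega, h1⟩

end TreeMetric

section TreeSum

variable [Fintype V] {G : SimpleGraph V} {p q : V} {D k₁ k₂ : ℕ} {g : ℕ → ℝ}

lemma pairBound_le_sum_eccClass (hd : IsTreeMetric G.dist) (hD : G.dist p q = D)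
    (hmax : ∀ x y, G.dist x y ≤ D) (hg : Monotone g) (h₁ : D ≤ 2 * k₁) (h₁₂ : k₁ ≤ k₂)
    (h₂ : k₂ ≤ D) :
    pairBound g #(eccClass G k₁) #(eccClass G k₂) (k₂ - k₁)
        (min (k₂ - k₁ + 2) (k₁ + k₂ - D)) (k₁ + k₂ - D) ≤
      ∑ x ∈ eccClass G k₁, ∑ y ∈ eccClass G k₂, g (G.dist x y) := by
  have hmem : ∀ {k x}, x ∈ eccClass G k ↔ max (G.dist p x) (G.dist q x) = k := fun {k x} => by
    rw [mem_eccClass, ecc_eq_max hd (by rwa [hD])]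
  have hboth : ∀ k, D < 2 * k → k ≤ D →
      (∃ x ∈ eccClass G k, G.dist q x < G.dist p x) ∧
        ∃ x ∈ eccClass G k, ¬ G.dist q x < G.dist p x := by
    intro k hk hkD
    obtain ⟨z, hz⟩ := hd.exists_right hD hkD
    obtain ⟨w, hw⟩ := hd.exists_left hD hkD
    exact ⟨⟨z, hmem.2 (by omega), by omega⟩, w, hmem.2 (by omega), by omega⟩
  exact pairBound_le_sum (s := fun x => G.dist q x < G.dist p x) hg (by omega) (by omega)
    (fun x hx y hy hne => hd.min_le_dist hD (hmem.1 hx) (hmem.1 hy) hne h₁₂)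
    (fun x hx y hy hs => hd.le_dist_of_not_iff hD (hmem.1 hx) (hmem.1 hy) hs)
    (fun y hy x hx x' hx' h h' => hd.eq_of_dist_eq hD (hmem.1 hx) (hmem.1 hx') (hmem.1 hy)
      h₁₂ h₁ h h')
    (fun h => hboth _ (by omega) (by omega)) (fun h => hboth _ (by omega) (by omega))

lemma of_sum_eccClass_le_pairBound (hd : IsTreeMetric G.dist) (hD : G.dist p q = D)
    (hmax : ∀ x y, G.dist x y ≤ D) (hg : StrictMono g) (h₁ : D ≤ 2 * k₁) (h₁₂ : k₁ ≤ k₂)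
    (h₂ : k₂ ≤ D)
    (hle : ∑ x ∈ eccClass G k₁, ∑ y ∈ eccClass G k₂, g (G.dist x y) ≤
      pairBound g #(eccClass G k₁) #(eccClass G k₂) (k₂ - k₁)
        (min (k₂ - k₁ + 2) (k₁ + k₂ - D)) (k₁ + k₂ - D)) :
    (∀ x ∈ eccClass G k₁, ∀ y ∈ eccClass G k₂,
      (G.dist q x < G.dist p x ↔ G.dist q y < G.dist p y) → G.dist x y ≤ k₂ - k₁ + 2) ∧
    (D + 2 < 2 * k₁ → ∀ x ∈ eccClass G k₁, ∀ x' ∈ eccClass G k₁,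
      ∀ y ∈ eccClass G k₂, ∀ y' ∈ eccClass G k₂, x ≠ x' → y ≠ y' →
      G.dist q x < G.dist p x → G.dist q x' < G.dist p x' →
      G.dist p y ≤ G.dist q y → G.dist p y' ≤ G.dist q y' → False) ∧
    (D + 2 < 2 * k₁ → ∀ x ∈ eccClass G k₁, ∀ x' ∈ eccClass G k₁,
      ∀ y ∈ eccClass G k₂, ∀ y' ∈ eccClass G k₂, x ≠ x' → y ≠ y' →
      G.dist p x ≤ G.dist q x → G.dist p x' ≤ G.dist q x' →
      G.dist q y < G.dist p y → G.dist q y' < G.dist p y' → False) := by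
  have hmem : ∀ {k x}, x ∈ eccClass G k ↔ max (G.dist p x) (G.dist q x) = k := fun {k x} => by
    rw [mem_eccClass, ecc_eq_max hd (by rwa [hD])]
  have hboth : ∀ k, D < 2 * k → k ≤ D →
      (∃ x ∈ eccClass G k, G.dist q x < G.dist p x) ∧
        ∃ x ∈ eccClass G k, G.dist p x ≤ G.dist q x := by
    intro k hk hkD
    obtain ⟨z, hz⟩ := hd.exists_right hD hkD
    obtain ⟨w, hw⟩ := hd.exists_left hD hkD
    exact ⟨⟨z, hmem.2 (by omega), by omega⟩, w, hmem.2 (by omega), by omega⟩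
  have key := fun (s : V → Prop) (hs : ∀ x y, ¬ (s x ↔ s y) →
        ¬ (G.dist q x < G.dist p x ↔ G.dist q y < G.dist p y))
      (hb : ∀ k, D < 2 * k → k ≤ D → (∃ x ∈ eccClass G k, s x) ∧ ∃ x ∈ eccClass G k, ¬ s x) =>
    of_sum_le_pairBound (s := s) hg (by omega) (by omega)
    (fun x hx y hy hne => hd.min_le_dist hD (hmem.1 hx) (hmem.1 hy) hne h₁₂)
    (fun x hx y hy h => hd.le_dist_of_not_iff hD (hmem.1 hx) (hmem.1 hy) (hs x y h))
    (fun y hy x hx x' hx' h h' => hd.eq_of_dist_eq hD (hmem.1 hx) (hmem.1 hx') (hmem.1 hy)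
      h₁₂ h₁ h h')
    (fun h => hb _ (by omega) (by omega)) (fun h => hb _ (by omega) (by omega)) hle
  have key₁ := key (fun x => G.dist q x < G.dist p x) (fun x y h => h) (by simpa using hboth)
  have key₂ := key (fun x => G.dist p x ≤ G.dist q x)
    (fun x y h h' => h (by omega)) (fun k hk hkD => by simpa [and_comm] using hboth k hk hkD)
  refine ⟨fun x hx y hy hs => (key₁.1 x hx y hy hs).trans (min_le_left _ _), ?_, ?_⟩
  · intro h x hx x' hx' y hy y' hy' hxx hyy a b a' b'
    exact key₁.2 (by omega) x hx x' hx' y hy y' hy' hxx hyy a b (by omega) (by omega)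
  · intro h x hx x' hx' y hy y' hy' hxx hyy a b a' b'
    exact key₂.2 (by omega) x hx x' hx' y hy y' hy' hxx hyy a b (by omega) (by omega)

end TreeSum

section Structure

variable [Fintype V] {G : SimpleGraph V} {p q : V} {D : ℕ} {g : ℕ → ℝ}

/-- The two ends of a diametral path can be chosen so that, in the case of equality, every vertex
off the path is attached to the half containing `p`. -/
lemma exists_ends_of_sum_le_pairBound (hd : IsTreeMetric G.dist) (hD : G.dist p q = D)
    (hmax : ∀ x y, G.dist x y ≤ D) (hg : StrictMono g)
    (hle : ∀ k₁ k₂, D ≤ 2 * k₁ → k₁ ≤ k₂ → k₂ ≤ D →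
      ∑ x ∈ eccClass G k₁, ∑ y ∈ eccClass G k₂, g (G.dist x y) ≤
        pairBound g #(eccClass G k₁) #(eccClass G k₂) (k₂ - k₁)
          (min (k₂ - k₁ + 2) (k₁ + k₂ - D)) (k₁ + k₂ - D)) :
    ∃ p q, G.dist p q = D ∧ ∀ x, D < G.dist p x + G.dist q x →
      G.dist p x + G.dist q x = D + 2 ∧ G.dist p x ≤ G.dist q x := by
  have hmem : ∀ {k x}, x ∈ eccClass G k ↔ max (G.dist p x) (G.dist q x) = k := fun {k x} => by
    rw [mem_eccClass, ecc_eq_max hd (by rwa [hD])]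
  have key := fun k₁ k₂ h₁ h₁₂ h₂ =>
    of_sum_eccClass_le_pairBound hd hD hmax hg h₁ h₁₂ h₂ (hle k₁ k₂ h₁ h₁₂ h₂)
  have hsum : ∀ x, D < G.dist p x + G.dist q x → G.dist p x + G.dist q x = D + 2 := by
    intro x hx
    have hxp := hmax p x
    have hxq := hmax q x
    have hev := hd.even_perimeter p q x
    have hev' := hd.comm q x
    rw [Nat.even_iff, hD] at hev
    by_cases h : G.dist q x < G.dist p x
    · obtain ⟨z, hz⟩ := hd.exists_right hD hxp
      have h1 := (key (G.dist p x) (G.dist p x) (by omega) le_rfl hxp).1 x (hmem.2 (by omega))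
        z (hmem.2 (by omega)) (by omega)
      have h2 := hd.triangle q z x
      have h3 := hd.comm z x
      omega
    · obtain ⟨z, hz⟩ := hd.exists_left hD hxq
      have h1 := (key (G.dist q x) (G.dist q x) (by omega) le_rfl hxq).1 x (hmem.2 (by omega))
        z (hmem.2 (by omega)) (by omega)
      have h2 := hd.triangle p z x
      have h3 := hd.comm z x
      omega
  by_cases hcase : ∀ x, D < G.dist p x + G.dist q x → G.dist p x ≤ G.dist q x
  · exact ⟨p, q, hD, fun x hx => ⟨hsum x hx, hcase x hx⟩⟩
  · push Not at hcase
    obtain ⟨x, hx, hxr⟩ := hcase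
    refine ⟨q, p, by rw [hd.comm, hD], fun y hy => ⟨by have := hsum y (by omega); omega, ?_⟩⟩
    by_contra! hyl
    have hx2 := hsum x hx
    have hy2 := hsum y (by omega)
    obtain ⟨x', hx'⟩ := hd.exists_right hD (hmax p x)
    obtain ⟨y', hy'⟩ := hd.exists_left hD (hmax q y)
    have hxx : x ≠ x' := fun h => by
      have := hmax p x
      rw [← h] at hx'
      omega
    have hyy : y ≠ y' := fun h => by
      have := hmax q y
      rw [← h] at hy'
      omega
    rcases le_total (G.dist p x) (G.dist q y) with h | h
    · exact (key _ _ (by omega) h (hmax q y)).2.1 (by omega) x (hmem.2 (by omega))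
        x' (hmem.2 (by omega)) y (hmem.2 (by omega)) y' (hmem.2 (by omega)) hxx hyy
        (by omega) (by omega) (by omega) (by omega)
    · exact (key _ _ (by omega) h (hmax p x)).2.2 (by omega) y (hmem.2 (by omega))
        y' (hmem.2 (by omega)) x (hmem.2 (by omega)) x' (hmem.2 (by omega)) hyy hxx
        (by omega) (by omega) (by omega) (by omega)

end Structure

section Iso

variable {r l : ℕ} {m : ℕ → ℕ}

lemma stdCat_adj_inl_inl_iff {a b : Fin (r + l)} :
    (stdCat r l m).Adj (Sum.inl a) (Sum.inl b) ↔ (a : ℕ) + 1 = b ∨ (b : ℕ) + 1 = a := by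
  constructor
  · intro h
    rw [stdCat, SimpleGraph.fromRel_adj] at h
    exact h.2
  · rintro (h | h)
    · exact stdCat_adj_inl h
    · exact (stdCat_adj_inl h).symm

lemma stdCat_adj_inr_inl_iff {s : (i : Fin (l - 1)) × Fin (m (i.1 + 2) - 2)} {a : Fin (r + l)} :
    (stdCat r l m).Adj (Sum.inr s) (Sum.inl a) ↔ (a : ℕ) = l - 1 - s.1 := by
  refine ⟨fun h => ?_, stdCat_adj_inr⟩
  rw [stdCat, SimpleGraph.fromRel_adj] at h
  rcases h.2 with h | h
  · exact h
  · exact h.elim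

lemma stdCat_not_adj_inr_inr {s t : (i : Fin (l - 1)) × Fin (m (i.1 + 2) - 2)} :
    ¬ (stdCat r l m).Adj (Sum.inr s) (Sum.inr t) := by
  rw [stdCat, SimpleGraph.fromRel_adj]
  simp [stdRel]

lemma card_eccClass_stdCat (hr : 1 ≤ r) (hl : 2 ≤ l) (hrl : l = r ∨ l = r + 1)
    (i : Fin (l - 1)) :
    #(eccClass (stdCat r l m) (r + i + 1)) =
      #{a : Fin (r + l) | max (a : ℕ) (r + l - 1 - a) = r + i + 1} + (m (i + 2) - 2) := by
  have h : eccClass (stdCat r l m) (r + i + 1) =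
      ({a : Fin (r + l) | max (a : ℕ) (r + l - 1 - a) = r + i + 1} : Finset _).disjSum
        ((Finset.univ : Finset (Fin (m (i.1 + 2) - 2))).map
          (Function.Embedding.sigmaMk (β := fun i : Fin (l - 1) => Fin (m (i.1 + 2) - 2)) i)) := by
    ext u
    rw [mem_eccClass, ecc_stdCat hr hl hrl]
    rcases u with a | ⟨j, t⟩
    · simp [stdPos]
    · simp only [stdPos, Finset.inr_mem_disjSum, Finset.mem_map, Finset.mem_univ, true_and,
        Function.Embedding.sigmaMk_apply]
      constructor
      · intro h
        obtain rfl : i = j := Fin.ext (by omega)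
        exact ⟨t, rfl⟩
      · rintro ⟨t', h⟩
        obtain rfl : i = j := congrArg Sigma.fst h
        omega
  rw [h, Finset.card_disjSum, Finset.card_map, Finset.card_univ, Fintype.card_fin]

variable [Fintype V] {G : SimpleGraph V} {p q : V}

lemma nonempty_iso_stdCat (hd : IsTreeMetric G.dist) (hr : 1 ≤ r) (hl : 2 ≤ l)
    (hrl : l = r ∨ l = r + 1) (hD : G.dist p q = r + l - 1)
    (hmax : ∀ x y, G.dist x y ≤ r + l - 1)
    (hoff : ∀ x, r + l - 1 < G.dist p x + G.dist q x →
      G.dist p x + G.dist q x = r + l + 1 ∧ G.dist p x ≤ G.dist q x)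
    (hcard : ∀ k, #(eccClass G k) = #(eccClass (stdCat r l m) k)) :
    Nonempty (G ≃g stdCat r l m) := by
  have hmem : ∀ {k x}, x ∈ eccClass G k ↔ max (G.dist p x) (G.dist q x) = k := fun {k x} => by
    rw [mem_eccClass, ecc_eq_max hd (by rwa [hD])]
  have hP : ∀ a : Fin (r + l), ∃ z, G.dist p z = a ∧ G.dist q z = r + l - 1 - a := fun a => by
    obtain ⟨z, h1, h2⟩ := hd.exists_between p q a (by omega)
    exact ⟨z, h1, by rw [hd.comm, h2, hD]⟩
  choose P hPp hPq using hP
  have hPinj : Function.Injective P := fun a b h => Fin.ext (by rw [← hPp a, h, hPp b])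
  have hPdist : ∀ x a, G.dist x (P a) + (r + l - 1) ≤
      max (G.dist p x + (r + l - 1 - a)) (G.dist q x + a) := fun x a => by
    have := hd.four_point x (P a) p q
    rwa [hd.comm x p, hd.comm x q, hd.comm (P a) p, hd.comm (P a) q, hPp, hPq, hD] at this
  have honP : ∀ x, G.dist p x + G.dist q x = r + l - 1 → ∃ a, P a = x := fun x hx => by
    refine ⟨⟨G.dist p x, by omega⟩, (hd.eq_of_eq_zero _ _ ?_).symm⟩
    have := hPdist x ⟨G.dist p x, by omega⟩
    simp only at this
    omega
  have hperim := fun x => hd.perim_le p q x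
  rw [hD] at hperim
  have hO : ∀ i : Fin (l - 1),
      #{x : V | r + l - 1 < G.dist p x + G.dist q x ∧ G.dist q x = r + i + 1} =
        m (i.1 + 2) - 2 := by
    intro i
    have h1 : eccClass G (r + i + 1) =
        (({a : Fin (r + l) | max (a : ℕ) (r + l - 1 - a) = r + i + 1} : Finset _).map
          ⟨P, hPinj⟩) ∪
        ({x : V | r + l - 1 < G.dist p x + G.dist q x ∧ G.dist q x = r + i + 1} : Finset V) := by
      ext x
      simp only [hmem, Finset.mem_union, Finset.mem_map, Finset.mem_filter, Finset.mem_univ,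
        true_and, Function.Embedding.coeFn_mk]
      constructor
      · intro h
        rcases (hperim x).eq_or_lt with h' | h'
        · obtain ⟨a, rfl⟩ := honP x h'.symm
          rw [hPp, hPq] at h
          exact Or.inl ⟨a, h, rfl⟩
        · have := hoff x h'
          exact Or.inr ⟨h', by omega⟩
      · rintro (⟨a, h, rfl⟩ | ⟨h, h'⟩)
        · rw [hPp, hPq, h]
        · have := hoff x h
          omega
    have h2 := hcard (r + i + 1)
    rw [card_eccClass_stdCat hr hl hrl, h1, Finset.card_union_of_disjoint, Finset.card_map] at h2
    · omega
    · rw [Finset.disjoint_left]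
      intro x hx hx'
      simp only [Finset.mem_map, Finset.mem_filter, Finset.mem_univ, true_and,
        Function.Embedding.coeFn_mk] at hx hx'
      obtain ⟨a, -, rfl⟩ := hx
      rw [hPp, hPq] at hx'
      omega
  obtain ⟨e, heinj, he, hesurj⟩ : ∃ e : (i : Fin (l - 1)) → Fin (m (i.1 + 2) - 2) → V,
      (∀ i, Function.Injective (e i)) ∧
      (∀ i t, r + l - 1 < G.dist p (e i t) + G.dist q (e i t) ∧ G.dist q (e i t) = r + i + 1) ∧
      ∀ (i : Fin (l - 1)) x, r + l - 1 < G.dist p x + G.dist q x → G.dist q x = r + i + 1 →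
        ∃ t, e i t = x := by
    refine ⟨fun i t => (Finset.equivFinOfCardEq (hO i)).symm t,
      fun i => Subtype.val_injective.comp (Equiv.injective _),
      fun i t => (Finset.mem_filter.1 ((Finset.equivFinOfCardEq (hO i)).symm t).2).2,
      fun i x h h' => ⟨Finset.equivFinOfCardEq (hO i)
        ⟨x, Finset.mem_filter.2 ⟨Finset.mem_univ x, h, h'⟩⟩, by simp⟩⟩
  let φ : StdVert r l m → V := Sum.elim P fun s => e s.1 s.2
  have hφ : Function.Bijective φ := by
    constructor
    · rintro (a | ⟨i, t⟩) (b | ⟨j, t'⟩) h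
      · exact congrArg Sum.inl (hPinj h)
      · have h1 := he j t'
        rw [show e j t' = P a from h.symm, hPp, hPq] at h1
        omega
      · have h1 := he i t
        rw [show e i t = P b from h, hPp, hPq] at h1
        omega
      · have h' : e i t = e j t' := h
        have h1 := (he i t).2
        have h2 := (he j t').2
        rw [h'] at h1
        obtain rfl : i = j := Fin.ext (by omega)
        rw [heinj i h']
    · intro x
      rcases (hperim x).eq_or_lt with h' | h'
      · obtain ⟨a, ha⟩ := honP x h'.symm
        exact ⟨Sum.inl a, ha⟩
      · have h1 := hoff x h'
        have h2 := hmax q x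
        obtain ⟨t, ht⟩ := hesurj ⟨G.dist q x - r - 1, by omega⟩ x h' (by simp only; omega)
        exact ⟨Sum.inr ⟨_, t⟩, ht⟩
  have hattach : ∀ i t (a : Fin (r + l)), G.dist (e i t) (P a) = 1 ↔ (a : ℕ) = l - 1 - i := by
    intro i t a
    have h1 := he i t
    have h2 := hoff _ h1.1
    constructor
    · intro h
      have t1 := hd.triangle p (P a) (e i t)
      have t2 := hd.triangle q (P a) (e i t)
      rw [hd.comm (P a), h, hPp] at t1
      rw [hd.comm (P a), h, hPq] at t2
      omega
    · intro h
      have h3 := hPdist (e i t) a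
      have h4 : G.dist (e i t) (P a) ≠ 0 := fun h0 => by
        have := hd.eq_of_eq_zero _ _ h0
        rw [this, hPp, hPq] at h1
        omega
      omega
  have hpend : ∀ i t j t', G.dist q (e i t) < G.dist q (e j t') →
      G.dist (e i t) (e j t') ≠ 1 := by
    intro i t j t' hlt h
    have h1 := he i t
    have h2 := he j t'
    have h3 := (hattach j t' ⟨l - 1 - j, by omega⟩).2 rfl
    have h4 := hd.triangle q (e i t) (e j t')
    have h5 := hd.four_point (e i t) (P ⟨l - 1 - j, by omega⟩) (e j t') q
    rw [h, hd.comm (P _) q, hPq, hd.comm (P _) (e j t'), h3, hd.comm _ q, hd.comm _ q] at h5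
    have h6 := hd.eq_of_eq_zero (e i t) (P ⟨l - 1 - j, by omega⟩) (by simp only at h5; omega)
    rw [h6, hPp, hPq] at h1
    omega
  have hadj : ∀ u v, G.Adj (φ u) (φ v) ↔ (stdCat r l m).Adj u v := by
    rintro (a | ⟨i, t⟩) (b | ⟨j, t'⟩)
    · rw [stdCat_adj_inl_inl_iff, ← dist_eq_one_iff_adj]
      change G.dist (P a) (P b) = 1 ↔ _
      have h1 := hPdist (P a) b
      have h2 := hd.triangle p (P a) (P b)
      have h3 := hd.triangle q (P a) (P b)
      rw [hPp, hPq] at h1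
      rw [hPp, hPp] at h2
      rw [hPq, hPq] at h3
      omega
    · rw [SimpleGraph.adj_comm, (stdCat r l m).adj_comm, stdCat_adj_inr_inl_iff,
        ← dist_eq_one_iff_adj]
      exact hattach j t' a
    · rw [stdCat_adj_inr_inl_iff, ← dist_eq_one_iff_adj]
      exact hattach i t b
    · refine iff_of_false ?_ stdCat_not_adj_inr_inr
      rw [← dist_eq_one_iff_adj]
      change G.dist (e i t) (e j t') ≠ 1
      rcases lt_trichotomy (G.dist q (e i t)) (G.dist q (e j t')) with h | h | h
      · exact hpend i t j t' h
      · intro h1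
        have h2 := hd.even_perimeter q (e i t) (e j t')
        rw [Nat.even_iff] at h2
        omega
      · rw [hd.comm]
        exact hpend j t' i t h
  exact ⟨(⟨Equiv.ofBijective φ hφ, fun {u v} => hadj u v⟩ : stdCat r l m ≃g G).symm⟩

end Iso

section Wiener

variable {W : Type*} {G : SimpleGraph V} {H : SimpleGraph W}

lemma dist_map_le_of_iso (hG : G.Connected) (φ : G ≃g H) (x y : V) :
    H.dist (φ x) (φ y) ≤ G.dist x y := by
  obtain ⟨w, hw⟩ := hG.exists_walk_length_eq_dist x y
  rw [← hw, ← SimpleGraph.Walk.length_map φ.toHom w]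
  exact SimpleGraph.dist_le _

variable [Fintype V] [Fintype W]

lemma wiener_eq_sum_eccClass {D : ℕ} (h : ∀ x, ecc G x ≤ D) (g : ℕ → ℝ) :
    wiener G g = (∑ a ∈ Finset.range (D + 1), ∑ b ∈ Finset.range (D + 1),
      ∑ x ∈ eccClass G a, ∑ y ∈ eccClass G b, g (G.dist x y) -
        ∑ a ∈ Finset.range (D + 1), #(eccClass G a) * g 0) / 2 := by
  have hmaps : ∀ x ∈ (Finset.univ : Finset V), ecc G x ∈ Finset.range (D + 1) := fun x _ => by
    have := h x
    simpa using Nat.lt_succ_of_le this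
  have hfib : ∀ f : V → ℝ, ∑ a ∈ Finset.range (D + 1), ∑ x ∈ eccClass G a, f x = ∑ x, f x :=
    fun f => by
      rw [← Finset.sum_fiberwise_of_maps_to hmaps]
      rfl
  have hdiag : ∑ a ∈ Finset.range (D + 1), #(eccClass G a) * g 0 =
      ∑ z ∈ (Finset.univ : Finset V).diag, g (G.dist z.1 z.2) := by
    rw [Finset.sum_diag]
    simp_rw [SimpleGraph.dist_self, ← hfib fun _ => g 0, Finset.sum_const, nsmul_eq_mul]
  have hall : ∑ a ∈ Finset.range (D + 1), ∑ b ∈ Finset.range (D + 1),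
      ∑ x ∈ eccClass G a, ∑ y ∈ eccClass G b, g (G.dist x y) = ∑ x, ∑ y, g (G.dist x y) := by
    rw [← hfib]
    refine Finset.sum_congr rfl fun a _ => ?_
    rw [Finset.sum_comm]
    exact Finset.sum_congr rfl fun x _ => hfib fun y => g (G.dist x y)
  rw [hdiag, hall, ← Finset.sum_product' Finset.univ Finset.univ fun x y => g (G.dist x y),
    ← Finset.diag_union_offDiag, Finset.sum_union (Finset.disjoint_diag_offDiag _),
    add_sub_cancel_left, wiener]

lemma dist_le_ecc (x y : V) : G.dist x y ≤ ecc G x :=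
  Finset.le_sup (f := fun y => G.dist x y) (Finset.mem_univ y)

lemma card_eccClass_eq_of_sameEccSeq (h : sameEccSeq G H) (k : ℕ) :
    #(eccClass G k) = #(eccClass H k) := by
  have := h k
  rw [Nat.card_eq_fintype_card, Nat.card_eq_fintype_card, Fintype.card_subtype,
    Fintype.card_subtype] at this
  convert this <;> exact Finset.ext fun x => by simp [mem_eccClass]

lemma wiener_eq_of_iso (hG : G.Connected) (hH : H.Connected) (φ : G ≃g H) (g : ℕ → ℝ) :
    wiener G g = wiener H g := by
  have hφ : ∀ x y, G.dist x y = H.dist (φ x) (φ y) := fun x y =>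
    le_antisymm (by simpa using dist_map_le_of_iso hH φ.symm (φ x) (φ y))
      (dist_map_le_of_iso hG φ x y)
  rw [wiener, wiener]
  congr 1
  refine Finset.sum_equiv (Equiv.prodCongr φ.toEquiv φ.toEquiv) (fun z => ?_) fun z _ => ?_
  · simp
  · rw [hφ]
    rfl

end Wiener

section Extremal

variable [Fintype V] {G : SimpleGraph V} {r l : ℕ} {m : ℕ → ℕ} {g : ℕ → ℝ} {p q : V}

lemma ecc_stdCat_bounds (hr : 1 ≤ r) (hl : 2 ≤ l) (hrl : l = r ∨ l = r + 1)
    (u : StdVert r l m) :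
    ecc (stdCat r l m) u ≤ r + l - 1 ∧ r + l - 1 ≤ 2 * ecc (stdCat r l m) u := by
  have := stdPos_le hl u
  rw [ecc_stdCat hr hl hrl]
  omega

lemma exists_ecc_stdCat_eq (hseq : sameEccSeq G (stdCat r l m)) (x : V) :
    ∃ u, ecc (stdCat r l m) u = ecc G x := by
  have h := card_eccClass_eq_of_sameEccSeq hseq (ecc G x)
  have hx : 0 < #(eccClass G (ecc G x)) := Finset.card_pos.2 ⟨x, mem_eccClass.2 rfl⟩
  obtain ⟨u, hu⟩ := Finset.card_pos.1 (h ▸ hx)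
  exact ⟨u, mem_eccClass.1 hu⟩

lemma exists_dist_eq_of_sameEccSeq (hr : 1 ≤ r) (hl : 2 ≤ l) (hrl : l = r ∨ l = r + 1)
    (hseq : sameEccSeq G (stdCat r l m)) : ∃ p q, G.dist p q = r + l - 1 := by
  have h := card_eccClass_eq_of_sameEccSeq hseq (r + l - 1)
  have hpos : 0 < #(eccClass (stdCat r l m) (r + l - 1)) := by
    refine Finset.card_pos.2 ⟨Sum.inl ⟨0, by omega⟩, mem_eccClass.2 ?_⟩
    rw [ecc_stdCat hr hl hrl]
    simp [stdPos]
  obtain ⟨p, hp⟩ := Finset.card_pos.1 (h ▸ hpos)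
  obtain ⟨q, -, hq⟩ := Finset.exists_mem_eq_sup Finset.univ ⟨p, Finset.mem_univ p⟩
    fun q => G.dist p q
  exact ⟨p, q, by rw [← mem_eccClass.1 hp, ecc, hq]⟩

lemma sum_eccClass_stdCat_le_sum_eccClass (hd : IsTreeMetric G.dist) (hr : 1 ≤ r) (hl : 2 ≤ l)
    (hrl : l = r ∨ l = r + 1) (hD : G.dist p q = r + l - 1)
    (hmax : ∀ x y, G.dist x y ≤ r + l - 1) (hg : Monotone g)
    (hcard : ∀ k, #(eccClass G k) = #(eccClass (stdCat r l m) k)) {a b : ℕ}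
    (ha : a ≤ r + l - 1) (hb : b ≤ r + l - 1) :
    ∑ x ∈ eccClass (stdCat r l m) a, ∑ y ∈ eccClass (stdCat r l m) b,
        g ((stdCat r l m).dist x y) ≤
      ∑ x ∈ eccClass G a, ∑ y ∈ eccClass G b, g (G.dist x y) := by
  wlog hab : a ≤ b generalizing a b
  · have := this hb ha (by omega)
    rw [Finset.sum_comm (s := eccClass G a), Finset.sum_comm (s := eccClass (stdCat r l m) a)]
    simpa only [SimpleGraph.dist_comm] using this
  by_cases ha' : r + l - 1 ≤ 2 * a
  · refine (sum_eccClass_stdCat_le hr hl hrl hg ha' hab hb).trans ?_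
    rw [← hcard, ← hcard]
    exact pairBound_le_sum_eccClass hd hD hmax hg ha' hab hb
  · have hempty : eccClass (stdCat r l m) a = ∅ := Finset.eq_empty_of_forall_notMem fun u hu => by
      have := (ecc_stdCat_bounds hr hl hrl u).2
      rw [mem_eccClass.1 hu] at this
      exact ha' this
    have hempty' : eccClass G a = ∅ := by
      rw [← Finset.card_eq_zero, hcard, hempty, Finset.card_empty]
    rw [hempty, hempty', Finset.sum_empty, Finset.sum_empty]

end Extremal

/-- If `g` is nonnegative and nondecreasing and `S = (r; m₂,…,m_l)` is a tree
eccentric sequence, then every tree `T` with eccentric sequence `S` satisfies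
`W(T;g) ≥ W(T(r; m₂,…,m_l); g)`; if `g` is strictly increasing, equality holds
iff `T ≅ T(r; m₂,…,m_l)`. -/
theorem stmt14 [Fintype V] (r l : ℕ) (m : ℕ → ℕ)
    (hr : 1 ≤ r) (hl : 2 ≤ l) (hrl : l = r ∨ l = r + 1)
    (hm : ∀ j : ℕ, 2 ≤ j → j ≤ l → 2 ≤ m j)
    (g : ℕ → ℝ) (hg0 : ∀ n : ℕ, 0 ≤ g n) (hgmono : Monotone g)
    (G : SimpleGraph V) (hG : G.IsTree) (hseq : sameEccSeq G (stdCat r l m)) :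
    wiener (stdCat r l m) g ≤ wiener G g ∧
      (StrictMono g →
        (wiener G g = wiener (stdCat r l m) g ↔ Nonempty (G ≃g stdCat r l m))) := by
  have hd := hG.isTreeMetric
  have hcard := card_eccClass_eq_of_sameEccSeq hseq
  have hecc : ∀ x, ecc G x ≤ r + l - 1 := fun x => by
    obtain ⟨u, hu⟩ := exists_ecc_stdCat_eq hseq x
    exact hu ▸ (ecc_stdCat_bounds hr hl hrl u).1
  have hmax : ∀ x y, G.dist x y ≤ r + l - 1 := fun x y => (dist_le_ecc x y).trans (hecc x)
  obtain ⟨p, q, hD⟩ := exists_dist_eq_of_sameEccSeq hr hl hrl hseq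
  have hle : ∀ a ∈ Finset.range (r + l - 1 + 1), ∀ b ∈ Finset.range (r + l - 1 + 1),
      ∑ x ∈ eccClass (stdCat r l m) a, ∑ y ∈ eccClass (stdCat r l m) b,
          g ((stdCat r l m).dist x y) ≤
        ∑ x ∈ eccClass G a, ∑ y ∈ eccClass G b, g (G.dist x y) := fun a ha b hb =>
    sum_eccClass_stdCat_le_sum_eccClass hd hr hl hrl hD hmax hgmono hcard
      (Finset.mem_range_succ_iff.1 ha) (Finset.mem_range_succ_iff.1 hb)
  have hW := wiener_eq_sum_eccClass hecc g
  have hW' := wiener_eq_sum_eccClass (fun u => (ecc_stdCat_bounds (m := m) hr hl hrl u).1) g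
  simp_rw [← hcard] at hW'
  have hsum := Finset.sum_le_sum fun a ha => Finset.sum_le_sum (hle a ha)
  refine ⟨by linarith, fun hg => ⟨fun heq => ?_, fun ⟨φ⟩ => ?_⟩⟩
  · have hterm := fun a ha => (Finset.sum_eq_sum_iff_of_le (hle a ha)).1
      ((Finset.sum_eq_sum_iff_of_le fun a ha => Finset.sum_le_sum (hle a ha)).1
        (by linarith) a ha)
    obtain ⟨p, q, hD, hoff⟩ := exists_ends_of_sum_le_pairBound hd hD hmax hg
      fun k₁ k₂ h₁ h₁₂ h₂ => by
        rw [← hterm k₁ (Finset.mem_range_succ_iff.2 (h₁₂.trans h₂)) k₂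
          (Finset.mem_range_succ_iff.2 h₂), hcard, hcard]
        exact sum_eccClass_stdCat_le hr hl hrl hgmono h₁ h₁₂ h₂
    exact nonempty_iso_stdCat hd hr hl hrl hD hmax
      (fun x hx => ⟨by have := (hoff x hx).1; omega, (hoff x hx).2⟩) hcard
  · exact wiener_eq_of_iso hG.connected (φ.connected_iff.1 hG.connected) φ g
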